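/- No W-state graph is simple: every W-state graph contains at least one pair of parallel edges. -/

import Mathlib

/-! Multigraphs (parallel edges allowed, no loops) with half-edge 2-colourings,
    matchings, W-state graphs and W-cones, following the paper. -/

structure Multigraph (V E : Type) where
  fst : E → V
  snd : E → V
  no_loop : ∀ e, fst e ≠ snd e

namespace Multigraph

variable {V E : Type} (G : Multigraph V E)

/-- Edge `e` is incident with vertex `v`. -/
def Inc (e : E) (v : V) : Prop := G.fst e = v ∨ G.snd e = v

/-- Adjacency using only edges in the edge set `F`. -/
def AdjIn (F : Set E) (u v : V) : Prop :=
  u ≠ v ∧ ∃ e ∈ F, G.Inc e u ∧ G.Inc e v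

def Adj (u v : V) : Prop := G.AdjIn Set.univ u v

/-- Reachability inside the vertex set `S`, using only edges in `F`. -/
def ReachOn (F : Set E) (S : Set V) (u v : V) : Prop :=
  Relation.ReflTransGen (fun a b => a ∈ S ∧ b ∈ S ∧ G.AdjIn F a b) u v

/-- The subgraph with edge set `F` induced on the vertex set `S` is connected. -/
def ConnectedOn (F : Set E) (S : Set V) : Prop :=
  ∀ u ∈ S, ∀ v ∈ S, G.ReachOn F S u v

def Connected : Prop := G.ConnectedOn Set.univ Set.univ

/-- `K` is a connected component of the subgraph with edge set `F` induced on `S`. -/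
def IsCompOn (F : Set E) (S : Set V) (K : Set V) : Prop :=
  ∃ v ∈ S, K = {u | u ∈ S ∧ G.ReachOn F S u v}

def IsMatching (M : Set E) : Prop :=
  ∀ e ∈ M, ∀ f ∈ M, e ≠ f → ∀ v : V, ¬ (G.Inc e v ∧ G.Inc f v)

/-- `M` is a perfect matching of the subgraph of `G` induced on `S`. -/
def IsPerfectMatchingOn (S : Set V) (M : Set E) : Prop :=
  (∀ e ∈ M, G.fst e ∈ S ∧ G.snd e ∈ S) ∧
  ∀ v ∈ S, ∃! e, e ∈ M ∧ G.Inc e v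

def IsPerfectMatching (M : Set E) : Prop :=
  G.IsPerfectMatchingOn Set.univ M

/-- Every edge lies in some perfect matching. -/
def MatchingCovered : Prop :=
  ∀ e : E, ∃ M : Set E, G.IsPerfectMatching M ∧ e ∈ M

/-- The subgraph with edge set `F` induced on `K` is factor-critical. -/
def FactorCriticalOn (F : Set E) (K : Set V) : Prop :=
  ∀ v ∈ K, ∃ M : Set E, M ⊆ F ∧ G.IsPerfectMatchingOn (K \ {v}) M

def FactorCritical : Prop := G.FactorCriticalOn Set.univ Set.univ

/-- `M` is a maximum matching among matchings using only edges in `F`. -/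
def IsMaxMatchingIn (F M : Set E) : Prop :=
  M ⊆ F ∧ G.IsMatching M ∧
  ∀ N : Set E, N ⊆ F → G.IsMatching N → N.ncard ≤ M.ncard

/-- Half-edge 2-colourings are functions `c : E → V → Bool`
    (`true` = red, `false` = blue; only the values at endpoints matter). -/
def Bichromatic (c : E → V → Bool) (e : E) : Prop :=
  c e (G.fst e) ≠ c e (G.snd e)

/-- The monochromatic edges. -/
def MonoEdges (c : E → V → Bool) : Set E := {e | ¬ G.Bichromatic c e}

/-- Every vertex has an incident red half-edge. -/
def VertexCond (c : E → V → Bool) : Prop :=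
  ∀ v : V, ∃ e : E, G.Inc e v ∧ c e v = true

/-- Every perfect matching contains exactly one bichromatic edge. -/
def MatchingCond (c : E → V → Bool) : Prop :=
  ∀ M : Set E, G.IsPerfectMatching M → ∃! e, e ∈ M ∧ G.Bichromatic c e

/-- All monochromatic edges are blue. -/
def NoRedMono (c : E → V → Bool) : Prop :=
  ∀ e : E, ¬ G.Bichromatic c e → c e (G.fst e) = false

/-- W-state graph. -/
def IsWState (c : E → V → Bool) : Prop :=
  G.MatchingCovered ∧ G.MatchingCond c ∧ G.VertexCond c ∧ G.NoRedMono c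

def Universal (v : V) : Prop := ∀ u : V, u ≠ v → G.Adj u v

/-- W-cone with apex `v`. -/
def IsWConeWithApex (c : E → V → Bool) (v : V) : Prop :=
  G.MatchingCovered ∧ G.Universal v ∧
  (∀ e : E, G.Bichromatic c e ↔ G.Inc e v) ∧
  G.VertexCond c ∧ G.NoRedMono c

def IsWCone (c : E → V → Bool) : Prop := ∃ v : V, G.IsWConeWithApex c v

/-- `e` and `f` are parallel edges (same pair of endpoints). -/
def Parallel (e f : E) : Prop :=
  (G.fst e = G.fst f ∧ G.snd e = G.snd f) ∨
  (G.fst e = G.snd f ∧ G.snd e = G.fst f)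

/-- The cut `δ(X)`. -/
def CutEdges (X : Set V) : Set E :=
  {e | (G.fst e ∈ X ∧ G.snd e ∉ X) ∨ (G.fst e ∉ X ∧ G.snd e ∈ X)}

/-- `δ(X)` is a tight cut. -/
def IsTightCut (X : Set V) : Prop :=
  ∀ M : Set E, G.IsPerfectMatching M → ∃! e, e ∈ M ∧ e ∈ G.CutEdges X

def Bipartite : Prop :=
  ∃ f : V → Bool, ∀ e : E, f (G.fst e) ≠ f (G.snd e)

/-- A brick: non-bipartite matching-covered graph with no non-trivial tight cut. -/
def IsBrick : Prop :=
  G.MatchingCovered ∧ ¬ G.Bipartite ∧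
  ∀ X : Set V, 2 ≤ X.ncard → 2 ≤ (Set.univ \ X).ncard → ¬ G.IsTightCut X

end Multigraph

section

open Matrix Polynomial

/-- The matrix obtained by deleting the entries at `(a, b)` and `(b, a)`. -/
def delPair {R V : Type*} [Zero R] [DecidableEq V] (A : Matrix V V R) (a b : V) : Matrix V V R :=
  fun i j => if (i = a ∧ j = b) ∨ (i = b ∧ j = a) then 0 else A i j

/-- The matrix obtained by deleting all entries in the rows and columns of `a` and `b`
other than those at `(a, b)` and `(b, a)`. -/
def isoPair {R V : Type*} [Zero R] [DecidableEq V] (A : Matrix V V R) (a b : V) : Matrix V V R :=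
  fun i j => if (i = a ∧ j = b) ∨ (i = b ∧ j = a) then A i j
    else if i = a ∨ i = b ∨ j = a ∨ j = b then 0 else A i j

theorem det_isoPair_eq_of_rows {R V : Type*} [CommRing R] [Fintype V] [DecidableEq V]
    (A A' : Matrix V V R) (a b : V) (hab : a ≠ b)
    (ha : ∀ j, A' a j = if j = b then A a b else 0)
    (hb : ∀ j, A' b j = if j = a then A b a else 0)
    (ho : ∀ i j, i ≠ a → i ≠ b → A' i j = A i j) : A'.det = (isoPair A a b).det := by
  rw [det_apply, det_apply]
  refine Finset.sum_congr rfl fun π _ => ?_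
  congr 1
  by_cases h1 : π b = a
  · by_cases h2 : π a = b
    · refine Finset.prod_congr rfl fun i _ => ?_
      by_cases hia : i = a
      · subst hia; rw [h2, hb]; simp [isoPair]
      by_cases hib : i = b
      · subst hib; rw [h1, ha]; simp [isoPair]
      have h3 : π i ≠ a := fun h => hib (π.injective (h.trans h1.symm))
      have h4 : π i ≠ b := fun h => hia (π.injective (h.trans h2.symm))
      rw [ho _ _ h3 h4]; simp [isoPair, hia, hib, h3, h4]
    · have h3 : π.symm b ≠ a := fun h => h2 (by rw [← h]; simp)
      rw [Finset.prod_eq_zero (Finset.mem_univ (π.symm b)),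
        Finset.prod_eq_zero (Finset.mem_univ (π.symm b))]
      · simp [isoPair, h3, hab.symm]
      · simp [hb, h3]
  · have h3 : π.symm a ≠ b := fun h => h1 (by rw [← h]; simp)
    rw [Finset.prod_eq_zero (Finset.mem_univ (π.symm a)),
      Finset.prod_eq_zero (Finset.mem_univ (π.symm a))]
    · simp [isoPair, h3, hab]
    · simp [ha, h3]

theorem det_discriminant_field {K V : Type*} [Field K] [CharZero K] [Fintype V] [DecidableEq V]
    (A : Matrix V V K) (hA : Aᵀ = -A) (hD : A.det ≠ 0) (a b : V) (hab : a ≠ b) :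
    (A.det - (delPair A a b).det - (isoPair A a b).det) ^ 2
      = 4 * ((delPair A a b).det * (isoPair A a b).det) := by
  have hu : IsUnit A.det := hD.isUnit
  have hsk : ∀ i j, A j i = - A i j := fun i j => by
    have := congrFun (congrFun hA i) j; simpa using this
  set S := A⁻¹ with hS
  have hST : Sᵀ = -S := by
    rw [hS, transpose_nonsing_inv, hA]
    exact inv_eq_left_inv (by rw [neg_mul_neg]; exact nonsing_inv_mul _ hu)
  have hSk : ∀ i j, S j i = - S i j := fun i j => by
    have := congrFun (congrFun hST i) j; simpa using this
  have hSd : ∀ i, S i i = 0 := fun i => self_eq_neg.mp (hSk i i)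
  have hAS : ∀ i j, ∑ k, A i k * S k j = if i = j then 1 else 0 := fun i j => by
    have := congrFun (congrFun (mul_nonsing_inv A hu) i) j
    rwa [Matrix.mul_apply, Matrix.one_apply] at this
  set t := A a b with ht
  have hba : A b a = -t := hsk a b
  let U : Matrix V (Fin 2) K := fun i k => if i = ![a, b] k then 1 else 0
  let W0 : Matrix (Fin 2) V K := ![fun j => if j = b then -t else 0, fun j => if j = a then t else 0]
  let W1 : Matrix (Fin 2) V K := ![fun j => (if j = b then t else 0) - A a j,
    fun j => (if j = a then -t else 0) - A b j]
  have hUW : ∀ (W : Matrix (Fin 2) V K) i j, (A + U * W) i j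
      = A i j + (if i = a then W 0 j else 0) + (if i = b then W 1 j else 0) := fun W i j => by
    rw [Matrix.add_apply, Matrix.mul_apply]
    simp only [U, Fin.sum_univ_two, add_assoc, ite_mul, one_mul, zero_mul]
    rfl
  have hXU : ∀ (X : Matrix (Fin 2) V K) (i k : Fin 2), (X * U) i k = X i (![a, b] k) := fun X i k => by
    rw [Matrix.mul_apply]
    simp [U]
  have h0 : (delPair A a b).det = A.det * (1 + t * S a b) ^ 2 := by
    have : delPair A a b = A + U * W0 := by
      ext i j
      rw [hUW]
      by_cases hia : i = a
      · subst hia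
        by_cases hj : j = b
        · subst hj; simp [delPair, W0, hab, ht]
        · simp [delPair, W0, hab, hj]
      · by_cases hib : i = b
        · subst hib
          by_cases hj : j = a
          · subst hj; simp [delPair, W0, hba, hia]
          · simp [delPair, W0, hj, hia]
        · simp [delPair, hia, hib]
    rw [this, det_add_mul _ _ hu, det_fin_two]
    simp only [Matrix.add_apply, Matrix.one_apply, hXU, Matrix.mul_apply, ← hS]
    simp [W0, hSd, hSk a b]
    left; ring
  have h1 : (isoPair A a b).det = A.det * (t * S a b) ^ 2 := by
    rw [← det_isoPair_eq_of_rows A (A + U * W1) a b hab, det_add_mul _ _ hu, det_fin_two]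
    · simp only [Matrix.add_apply, Matrix.one_apply, hXU, Matrix.mul_apply, ← hS]
      simp [W1, hSd, hSk a b, sub_mul, Finset.sum_sub_distrib, hAS, hab, hab.symm]
      left; ring
    · intro j; rw [hUW]; simp [W1, hab, ht]
    · intro j; rw [hUW]; simp [W1, hab.symm, hba]
    · intro i j hi hj; rw [hUW]; simp [hi, hj]
  rw [h0, h1]; ring

theorem det_discriminant {R V : Type*} [CommRing R] [IsDomain R] [CharZero R] [Fintype V]
    [DecidableEq V] (A : Matrix V V R) (hA : Aᵀ = -A) (hD : A.det ≠ 0) (a b : V) (hab : a ≠ b) :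
    (A.det - (delPair A a b).det - (isoPair A a b).det) ^ 2
      = 4 * ((delPair A a b).det * (isoPair A a b).det) := by
  let φ := algebraMap R (FractionRing R)
  have hφ : Function.Injective φ := IsFractionRing.injective R (FractionRing R)
  have : CharZero (FractionRing R) := charZero_of_injective_algebraMap hφ
  have e0 : delPair (A.map φ) a b = (delPair A a b).map φ := by
    ext i j; simp only [delPair, Matrix.map_apply]; split_ifs <;> simp
  have e1 : isoPair (A.map φ) a b = (isoPair A a b).map φ := by
    ext i j; simp only [isoPair, Matrix.map_apply]; split_ifs <;> simp
  have hdet : ∀ M : Matrix V V R, (M.map φ).det = φ M.det := fun M => (φ.map_det M).symm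
  have key := det_discriminant_field (A.map φ) (by
    ext i j
    have := congrArg φ (congrFun (congrFun hA i) j)
    simpa using this)
    (by rw [hdet]; simpa using (map_ne_zero_iff φ hφ).2 hD) a b hab
  rw [e0, e1, hdet, hdet, hdet] at key
  apply hφ
  simpa only [map_pow, map_sub, map_mul, map_ofNat] using key

theorem eq_C_mul_X_pow_of_sq {K : Type*} [Field K] {Y : K[X]} {q : K} {m : ℕ}
    (h : Y ^ 2 = C q * (X ^ m) ^ 2) : ∃ c, Y = C c * X ^ m := by
  have hd : (X ^ m : K[X]) ∣ Y := by
    have : (X ^ m : K[X]) ^ 2 ∣ Y ^ 2 := by rw [h]; exact Dvd.intro_left _ rfl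
    exact (UniqueFactorizationMonoid.pow_dvd_pow_iff_dvd two_ne_zero).1 this
  obtain ⟨Z, rfl⟩ := hd
  have hZ : Z ^ 2 = C q := by
    have h0 : (X ^ m : K[X]) ^ 2 ≠ 0 := pow_ne_zero _ (pow_ne_zero _ X_ne_zero)
    apply mul_left_cancel₀ h0
    rw [← mul_pow, h, mul_comm]
  have hn : Z.natDegree = 0 := by
    have := congrArg natDegree hZ
    rw [natDegree_pow, natDegree_C] at this
    omega
  exact ⟨Z.coeff 0, by rw [mul_comm, ← eq_C_of_natDegree_eq_zero hn]⟩

/-- The matrix whose entries are the monomials `M i j * X ^ w i j`. -/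
noncomputable def monomialMatrix {K V : Type*} [Field K] (M : Matrix V V K) (w : V → V → ℕ) :
    Matrix V V K[X] :=
  fun i j => C (M i j) * X ^ w i j

theorem det_monomialMatrix {K V : Type*} [Field K] [CharZero K] [Fintype V] [DecidableEq V]
    (w : V → V → ℕ) (hw : ∀ i j, w i j = w j i) (m : ℕ) (M : Matrix V V K)
    (hM : ∀ i j, M j i = - M i j)
    (hm : ∀ f : V → V, Function.Involutive f → (∀ v, M v (f v) ≠ 0) → ∑ v, w v (f v) = m) :
    ∃ c, (monomialMatrix M w).det = C c * X ^ m := by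
  classical
  induction hn : (Finset.univ.filter fun x : V × V => M x.1 x.2 ≠ 0).card
    using Nat.strong_induction_on generalizing M with
  | _ n ih =>
  subst hn
  by_cases hbr : ∃ a b d, M a b ≠ 0 ∧ M a d ≠ 0 ∧ b ≠ d
  · obtain ⟨a, b, d, h1, h2, hbd⟩ := hbr
    have hab : a ≠ b := by
      rintro rfl; exact h1 (self_eq_neg.mp (hM a a))
    by_cases hD : (monomialMatrix M w).det = 0
    · exact ⟨0, by simp [hD]⟩
    have sub : ∀ (N : Matrix V V K), (∀ i j, N j i = - N i j) → (∀ i j, N i j ≠ 0 → M i j ≠ 0) →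
        (∃ i j, M i j ≠ 0 ∧ N i j = 0) → ∃ c, (monomialMatrix N w).det = C c * X ^ m := by
      intro N hN hNM ⟨i, j, hij, hij'⟩
      refine ih _ ?_ N hN (fun f hf h => hm f hf fun v => hNM _ _ (h v)) rfl
      apply Finset.card_lt_card
      refine (Finset.ssubset_iff_of_subset ?_).2 ⟨(i, j), by simpa using hij, by simpa using hij'⟩
      intro x; simpa using hNM x.1 x.2
    obtain ⟨c0, h0⟩ := sub (delPair M a b) (by
        intro i j; simp only [delPair, hM i j]
        by_cases h : (i = a ∧ j = b) ∨ (i = b ∧ j = a)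
        · rw [if_pos h, if_pos (by tauto)]; simp
        · rw [if_neg h, if_neg (by tauto)])
      (by intro i j; simp only [delPair]; split_ifs <;> simp)
      ⟨a, b, h1, by simp [delPair]⟩
    obtain ⟨c1, h1⟩ := sub (isoPair M a b) (by
        intro i j; simp only [isoPair, hM i j]
        by_cases h : (i = a ∧ j = b) ∨ (i = b ∧ j = a)
        · rw [if_pos h, if_pos (by tauto)]
        rw [if_neg h, if_neg (by tauto)]
        by_cases h : i = a ∨ i = b ∨ j = a ∨ j = b
        · rw [if_pos h, if_pos (by tauto)]; simp
        · rw [if_neg h, if_neg (by tauto)])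
      (by intro i j; simp only [isoPair]; split_ifs <;> simp)
      ⟨a, d, h2, by simp [isoPair, hbd.symm, hab]⟩
    have e0 : delPair (monomialMatrix M w) a b = monomialMatrix (delPair M a b) w := by
      ext1 i j; simp only [delPair, monomialMatrix]; split_ifs <;> simp
    have e1 : isoPair (monomialMatrix M w) a b = monomialMatrix (isoPair M a b) w := by
      ext1 i j; simp only [isoPair, monomialMatrix]; split_ifs <;> simp
    have key := det_discriminant (monomialMatrix M w)
      (by ext1 i j; simp [monomialMatrix, hw j i, hM i j]) hD a b hab
    rw [e0, e1, h0, h1] at key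
    have k2 : ((monomialMatrix M w).det - C (c0 + c1) * X ^ m) ^ 2
        = C (4 * (c0 * c1)) * (X ^ m) ^ 2 := by
      have h4 : (C (4 : K)) = 4 := rfl
      simp only [C_mul, C_add, h4]
      linear_combination key
    obtain ⟨c, hc⟩ := eq_C_mul_X_pow_of_sq k2
    exact ⟨c + (c0 + c1), by rw [C_add, add_mul, ← hc]; ring⟩
  · push Not at hbr
    have : ∀ π : Equiv.Perm V, ∃ c, ∏ i, monomialMatrix M w (π i) i = C c * X ^ m := by
      intro π
      by_cases hz : ∀ i, M (π i) i ≠ 0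
      · refine ⟨∏ i, M (π i) i, ?_⟩
        simp only [monomialMatrix]
        rw [Finset.prod_mul_distrib, Finset.prod_pow_eq_pow_sum, map_prod]
        have hz' : ∀ i, M i (π i) ≠ 0 := fun i => by rw [hM (π i) i]; simpa using hz i
        rw [← hm π (fun i => hbr (π i) _ _ (hz' (π i)) (hz i)) hz']
        exact congrArg _ (congrArg _ (Finset.sum_congr rfl fun i _ => hw _ _))
      · push Not at hz
        obtain ⟨i, hi⟩ := hz
        exact ⟨0, by rw [Finset.prod_eq_zero (Finset.mem_univ i)] <;> simp [monomialMatrix, hi]⟩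
    choose c hc using this
    refine ⟨∑ π, Equiv.Perm.sign π * c π, ?_⟩
    rw [det_apply', map_sum, Finset.sum_mul]
    refine Finset.sum_congr rfl fun π _ => ?_
    rw [hc, map_mul, mul_assoc]; simp

theorem det_add_X_smul {K V : Type*} [Field K] [CharZero K] [Fintype V] [DecidableEq V]
    {H B : V → V → Prop} (hBs : ∀ i j, B i j → B j i) (hHB : ∀ i j, H i j → ¬ B i j)
    {m : ℕ} (hm : ∀ f : V → V, Function.Involutive f → (∀ v, H v (f v) ∨ B v (f v)) →
      {v | B v (f v)}.ncard = m)
    {T D : Matrix V V K} (hT : ∀ i j, T j i = - T i j) (hD : ∀ i j, D j i = - D i j)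
    (hTH : ∀ i j, T i j ≠ 0 → H i j) (hDB : ∀ i j, D i j ≠ 0 → B i j) :
    ∃ c, (T.map C + (X : K[X]) • D.map C).det = C c * X ^ m := by
  classical
  have hBs' : ∀ i j, B i j ↔ B j i := fun i j => ⟨hBs i j, hBs j i⟩
  have e : T.map C + (X : K[X]) • D.map C
      = monomialMatrix (T + D) (fun i j => if B i j then 1 else 0) := by
    ext1 i j
    simp only [monomialMatrix, Matrix.add_apply, Matrix.smul_apply, Matrix.map_apply, smul_eq_mul]
    by_cases h : B i j
    · have : T i j = 0 := by by_contra h'; exact hHB _ _ (hTH _ _ h') h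
      simp [h, this]
    · have : D i j = 0 := by by_contra h'; exact h (hDB _ _ h')
      simp [h, this]
  rw [e]
  refine det_monomialMatrix _ (fun i j => by simp [hBs' i j]) m _
    (fun i j => by simp [hT i j, hD i j]; ring) fun f hf h => ?_
  rw [← hm f hf fun v => ?_]
  · simp [Set.ncard_eq_toFinset_card']
  · by_cases h1 : T v (f v) = 0
    · exact Or.inr (hDB _ _ fun h2 => h v (by simp [h1, h2]))
    · exact Or.inl (hTH _ _ h1)

/-- The skew-symmetric matrix with `1` at `(a, b)`, `-1` at `(b, a)` and `0` elsewhere. -/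
def skewUnit (R : Type*) {V : Type*} [Ring R] [DecidableEq V] (a b : V) : Matrix V V R :=
  single a b 1 - single b a 1

theorem skewUnit_neg (R : Type*) {V : Type*} [Ring R] [DecidableEq V] (a b i j : V) :
    skewUnit R a b j i = - skewUnit R a b i j := by
  simp [skewUnit, single_apply, and_comm]

theorem skewUnit_mulVec {R V : Type*} [Ring R] [Fintype V] [DecidableEq V] (a b : V) (w : V → R) :
    skewUnit R a b *ᵥ w = w b • Pi.single a 1 - w a • Pi.single b 1 := by
  ext i
  simp [skewUnit, sub_mulVec, single_mulVec, Function.update_apply, Pi.single_apply]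

open scoped Classical in
/-- The skew-symmetric matrix supported on `H` with entries `x (i, j) - x (j, i)`. -/
noncomputable def skewOn {R V : Type*} [Ring R] (H : V → V → Prop) (x : V × V → R) :
    Matrix V V R :=
  fun i j => if H i j then x (i, j) - x (j, i) else 0

theorem exists_skewOn_det_ne_zero {V : Type*} [Fintype V] [DecidableEq V]
    {H : V → V → Prop} {f : V → V} (hf : Function.Involutive f) {v : V}
    (hv : f v ≠ v) (hvH : ¬ H v (f v)) (hvH' : ¬ H (f v) v)
    (hH : ∀ u, u ≠ v → u ≠ f v → H u (f u)) (hne : ∀ u, ¬ H u u) :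
    ∃ x : V × V → ℚ, (skewOn H x + skewUnit ℚ v (f v)).det ≠ 0 := by
  classical
  let a : V → ℚ := fun v => ((Fintype.equivFin V v : ℕ) : ℚ)
  have ha : Function.Injective a := fun u w h => by
    apply (Fintype.equivFin V).injective
    apply Fin.ext
    simpa [a] using h
  refine ⟨fun e => if f e.1 = e.2 then a e.1 else 0, fun h0 => ?_⟩
  obtain ⟨w, hw, hw0⟩ := exists_mulVec_eq_zero_iff.2 h0
  set A := skewOn H (fun e => if f e.1 = e.2 then a e.1 else 0) + skewUnit ℚ v (f v) with hA
  have hoff : ∀ i j, f i ≠ j → A i j = 0 := by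
    intro i j hij
    have hji : f j ≠ i := fun h => hij (by rw [← h, hf])
    have h1 : ¬ (v = i ∧ f v = j) := by rintro ⟨rfl, rfl⟩; exact hij rfl
    have h2 : ¬ (f v = i ∧ v = j) := by rintro ⟨rfl, rfl⟩; exact hji rfl
    simp [hA, skewOn, skewUnit, hij, hji, h1, h2]
  have hon : ∀ i, A i (f i) ≠ 0 := by
    intro i
    by_cases h1 : i = v
    · subst h1
      simp [hA, skewOn, skewUnit, hvH, hv]
    by_cases h2 : i = f v
    · subst h2
      simp [hA, skewOn, skewUnit, hvH', hv, hf v]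
    · have h3 := hH i h1 h2
      have h4 : f i ≠ i := fun h => hne i (by rwa [h] at h3)
      have h5 : a i - a (f i) ≠ 0 := sub_ne_zero.2 fun h => h4 (ha h).symm
      simpa [hA, skewOn, skewUnit, single_apply, hf i, h3, Ne.symm h1, Ne.symm h2] using h5
  apply hw
  ext j
  have := congrFun hw0 (f j)
  rw [mulVec, dotProduct, Finset.sum_eq_single j (fun k _ hk => by
    rw [hoff _ _ (by rw [hf]; exact hk.symm), zero_mul]) (by simp)] at this
  have h6 := hon (f j)
  rw [hf] at h6
  simpa [h6] using this

theorem exists_skew_forall_det_ne_zero {V : Type*} [Fintype V] [DecidableEq V]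
    {H : V → V → Prop} (hHs : ∀ i j, H i j → H j i) (hne : ∀ u, ¬ H u u) (p : V → V)
    (hp : ∀ v, ¬ H v (p v)) (hpne : ∀ v, p v ≠ v)
    (hcov : ∀ v, ∃ f : V → V, Function.Involutive f ∧ f v = p v ∧
      ∀ u, u ≠ v → u ≠ f v → H u (f u)) :
    ∃ T : Matrix V V ℚ, (∀ i j, T j i = - T i j) ∧ (∀ i j, T i j ≠ 0 → H i j) ∧
      ∀ v, (T + skewUnit ℚ v (p v)).det ≠ 0 := by
  classical
  let P : V → MvPolynomial (V × V) ℚ := fun v =>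
    (skewOn H MvPolynomial.X + skewUnit (MvPolynomial (V × V) ℚ) v (p v)).det
  have hP : ∀ v (x : V × V → ℚ), MvPolynomial.eval x (P v)
      = (skewOn H x + skewUnit ℚ v (p v)).det := by
    intro v x
    simp only [P]
    rw [RingHom.map_det]
    congr 1
    ext i j
    simp only [RingHom.mapMatrix_apply, Matrix.map_apply, Matrix.add_apply, map_add, skewOn,
      skewUnit, Matrix.sub_apply, map_sub, single_apply, apply_ite (MvPolynomial.eval x),
      MvPolynomial.eval_X, map_zero, map_one]
  have hprod : ∏ v, P v ≠ 0 := by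
    rw [Finset.prod_ne_zero_iff]
    intro v _ h0
    obtain ⟨f, hf, hfv, hfH⟩ := hcov v
    obtain ⟨x, hx⟩ := exists_skewOn_det_ne_zero hf (v := v) (by rw [hfv]; exact hpne v)
      (by rw [hfv]; exact hp v) (by rw [hfv]; exact fun h => hp v (hHs _ _ h)) hfH hne
    apply hx
    rw [hfv, ← hP, h0, map_zero]
  obtain ⟨x, hx⟩ : ∃ x, MvPolynomial.eval x (∏ v, P v) ≠ 0 := by
    by_contra! h
    exact hprod (MvPolynomial.funext fun x => by rw [h x, map_zero])
  refine ⟨skewOn H x, fun i j => ?_, fun i j => ?_, fun v h => hx ?_⟩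
  · by_cases h : H i j
    · simp [skewOn, h, hHs i j h]
    · simp [skewOn, h, show ¬ H j i from fun h' => h (hHs j i h')]
  · intro h; by_contra h'; simp [skewOn, h'] at h
  · rw [map_prod]
    exact Finset.prod_eq_zero (Finset.mem_univ v) (by rw [hP, h])

theorem skew_dotProduct {R V : Type*} [CommRing R] [Fintype V] {A : Matrix V V R}
    (hA : ∀ i j, A j i = - A i j) (x y : V → R) : x ⬝ᵥ A *ᵥ y = - (A *ᵥ x ⬝ᵥ y) := by
  have : Aᵀ = -A := by ext i j; exact hA i j
  rw [dotProduct_mulVec, ← mulVec_transpose, this, neg_mulVec, neg_dotProduct]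

theorem skew_dotProduct_self {R V : Type*} [CommRing R] [IsDomain R] [CharZero R] [Fintype V]
    {A : Matrix V V R}
    (hA : ∀ i j, A j i = - A i j) (x : V → R) : x ⬝ᵥ A *ᵥ x = 0 := by
  have := skew_dotProduct hA x x
  rw [dotProduct_comm (A *ᵥ x)] at this
  exact self_eq_neg.mp this

section
variable {V : Type*} [Fintype V] [DecidableEq V] {T : Matrix V V ℚ}

theorem eq_zero_of_ker_of_apply {a b : V} (hd : (T + skewUnit ℚ a b).det ≠ 0)
    {y : V → ℚ} (hy : T *ᵥ y = 0) (ha : y a = 0) (hb : y b = 0) : y = 0 := by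
  apply eq_zero_of_mulVec_eq_zero hd
  rw [add_mulVec, hy, skewUnit_mulVec, ha, hb]; simp

theorem exists_ker_basis (hT : ∀ i j, T j i = - T i j) (hT0 : T.det = 0) {a b : V}
    (hd : (T + skewUnit ℚ a b).det ≠ 0) :
    ∃ n₁ n₂ : V → ℚ, T *ᵥ n₁ = 0 ∧ T *ᵥ n₂ = 0 ∧ n₁ a = 1 ∧ n₁ b = 0 ∧ n₂ a = 0 ∧ n₂ b = 1 := by
  obtain ⟨w, hw0, hw⟩ := exists_mulVec_eq_zero_iff.2 hT0
  have hsk : ∀ i j, (T + skewUnit ℚ a b) j i = - (T + skewUnit ℚ a b) i j := fun i j => by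
    rw [Matrix.add_apply, Matrix.add_apply, hT, skewUnit_neg, neg_add]
  have hsol : ∀ c : V → ℚ, ∃ y, (T + skewUnit ℚ a b) *ᵥ y = c := fun c =>
    ⟨(T + skewUnit ℚ a b)⁻¹ *ᵥ c, by
      rw [mulVec_mulVec, mul_nonsing_inv _ hd.isUnit, one_mulVec]⟩
  have hwT : ∀ y, w ⬝ᵥ T *ᵥ y = 0 := fun y => by rw [skew_dotProduct hT, hw]; simp
  by_cases hwa : w a = 0
  · have hwb : w b ≠ 0 := fun h => hw0 (eq_zero_of_ker_of_apply hd hw hwa h)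
    obtain ⟨y, hy⟩ := hsol (Pi.single b 1)
    have h1 := skew_dotProduct_self hsk y
    rw [hy] at h1
    have hyb : y b = 0 := by simpa using h1
    rw [add_mulVec, skewUnit_mulVec, hyb, zero_smul, zero_sub] at hy
    have hTy : T *ᵥ y = (1 + y a) • Pi.single b 1 := by
      rw [add_smul, one_smul]; exact sub_eq_iff_eq_add.1 (by rwa [sub_eq_add_neg])
    have h2 := hwT y
    rw [hTy] at h2
    have h3 : 1 + y a = 0 := by simpa [hwb] using h2
    rw [h3, zero_smul] at hTy
    refine ⟨-y, (w b)⁻¹ • w, ?_, ?_, ?_, ?_, ?_, ?_⟩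
    · rw [mulVec_neg, hTy, neg_zero]
    · rw [mulVec_smul, hw, smul_zero]
    · simp; linarith
    · simp [hyb]
    · simp [hwa]
    · simp [hwb]
  · obtain ⟨y, hy⟩ := hsol (Pi.single a 1)
    have h1 := skew_dotProduct_self hsk y
    rw [hy] at h1
    have hya : y a = 0 := by simpa using h1
    rw [add_mulVec, skewUnit_mulVec, hya, zero_smul, sub_zero] at hy
    have hTy : T *ᵥ y = (1 - y b) • Pi.single a 1 := by
      rw [sub_smul, one_smul]; exact eq_sub_of_add_eq hy
    have h2 := hwT y
    rw [hTy] at h2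
    have h3 : 1 - y b = 0 := by simpa [hwa] using h2
    rw [h3, zero_smul] at hTy
    refine ⟨(w a)⁻¹ • (w - w b • y), y, ?_, hTy, ?_, ?_, hya, by linarith⟩
    · rw [mulVec_smul, mulVec_sub, mulVec_smul, hw, hTy]; simp
    · simp [hya, hwa]
    · have : y b = 1 := by linarith
      simp [this]

theorem exists_signed_of_generic [Nonempty V] {H : V → V → Prop} (hHs : ∀ i j, H i j → H j i)
    {p : V → V}
    (hsing : ∀ S : Matrix V V ℚ, (∀ i j, S j i = - S i j) → (∀ i j, S i j ≠ 0 → H i j) →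
      S.det = 0)
    (hT : ∀ i j, T j i = - T i j) (hTH : ∀ i j, T i j ≠ 0 → H i j)
    (hd : ∀ v, (T + skewUnit ℚ v (p v)).det ≠ 0) :
    ∃ (S : Matrix V V ℚ) (ε : V → ℚ), (∀ i j, S j i = - S i j) ∧ (∀ i j, S i j ≠ 0 → H i j) ∧
      (∀ i, ε i = 1 ∨ ε i = -1) ∧ (∀ v, ε (p v) = - ε v) ∧ (∀ i j, S i j ≠ 0 → ε i = ε j) ∧
      S *ᵥ 1 = 0 ∧ ∀ y, S *ᵥ y = 0 → ∃ α β : ℚ, y = α • 1 + β • ε := by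
  obtain ⟨a⟩ := ‹Nonempty V›
  obtain ⟨n₁, n₂, hn₁, hn₂, h1a, h1b, h2a, h2b⟩ :=
    exists_ker_basis hT (hsing T hT hTH) (hd a)
  have hspan : ∀ y, T *ᵥ y = 0 → y = y a • n₁ + y (p a) • n₂ := by
    intro y hy
    rw [← sub_eq_zero]
    apply eq_zero_of_ker_of_apply (hd a)
    · rw [mulVec_sub, mulVec_add, mulVec_smul, mulVec_smul, hn₁, hn₂, hy]; simp
    · simp [h1a, h2a]
    · simp [h1b, h2b]
  have hpar : ∀ i j, H i j → n₁ i * n₂ j = n₁ j * n₂ i := by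
    intro i j hij
    by_contra hΔ
    have hne : i ≠ j := by rintro rfl; exact hΔ rfl
    have hdet : (T + skewUnit ℚ i j).det = 0 := by
      apply hsing
      · intro x y; rw [Matrix.add_apply, Matrix.add_apply, hT, skewUnit_neg, neg_add]
      · intro x y hxy
        by_cases h1 : T x y = 0
        · rw [Matrix.add_apply, h1, zero_add] at hxy
          by_cases h2 : i = x ∧ j = y
          · rw [← h2.1, ← h2.2]; exact hij
          by_cases h3 : j = x ∧ i = y
          · rw [← h3.1, ← h3.2]; exact hHs _ _ hij
          · simp [skewUnit, h2, h3] at hxy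
        · exact hTH _ _ h1
    obtain ⟨w, hw0, hw⟩ := exists_mulVec_eq_zero_iff.2 hdet
    rw [add_mulVec, skewUnit_mulVec] at hw
    have hdot : ∀ n, T *ᵥ n = 0 → w j * n i = w i * n j := by
      intro n hn
      have h := congrArg (n ⬝ᵥ ·) hw
      simp only [dotProduct_add, skew_dotProduct hT n w, hn, dotProduct_sub, dotProduct_smul] at h
      simpa [sub_eq_zero] using h
    have e1 := hdot n₁ hn₁
    have e2 := hdot n₂ hn₂
    have hΔ' := sub_ne_zero.2 hΔ
    have hwj : w j = 0 := by
      have : w j * (n₁ i * n₂ j - n₁ j * n₂ i) = 0 := by linear_combination n₂ j * e1 - n₁ j * e2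
      simpa [hΔ'] using this
    have hwi : w i = 0 := by
      have : w i * (n₁ i * n₂ j - n₁ j * n₂ i) = 0 := by linear_combination n₂ i * e1 - n₁ i * e2
      simpa [hΔ'] using this
    rw [hwj, hwi, zero_smul, zero_smul, sub_zero, add_zero] at hw
    have hs := hspan w hw
    have f1 := congrFun hs i
    have f2 := congrFun hs j
    simp only [hwi, hwj, Pi.add_apply, Pi.smul_apply, smul_eq_mul] at f1 f2
    have g1 : w a = 0 := by
      have : w a * (n₁ i * n₂ j - n₁ j * n₂ i) = 0 := by linear_combination n₂ i * f2 - n₂ j * f1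
      simpa [hΔ'] using this
    have g2 : w (p a) = 0 := by
      have : w (p a) * (n₁ i * n₂ j - n₁ j * n₂ i) = 0 := by
        linear_combination n₁ j * f1 - n₁ i * f2
      simpa [hΔ'] using this
    rw [g1, g2] at hs
    exact hw0 (by simpa using hs)
  have hcomb : ∀ v, ∀ α β : ℚ, α * n₁ v + β * n₂ v = 0 → α * n₁ (p v) + β * n₂ (p v) = 0 →
      α = 0 ∧ β = 0 := by
    intro v α β h1 h2
    have h0 : α • n₁ + β • n₂ = 0 := by
      apply eq_zero_of_ker_of_apply (hd v) _ (by simpa using h1) (by simpa using h2)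
      rw [mulVec_add, mulVec_smul, mulVec_smul, hn₁, hn₂]; simp
    have e1 := congrFun h0 a
    have e2 := congrFun h0 (p a)
    simp [h1a, h2a, h1b, h2b] at e1 e2
    exact ⟨e1, e2⟩
  have hcross : ∀ v, n₁ v * n₂ (p v) ≠ n₁ (p v) * n₂ v := by
    intro v h
    have h1 := hcomb v (n₂ v) (-n₁ v) (by ring) (by linear_combination -h)
    have h2 := hcomb v (n₂ (p v)) (-n₁ (p v)) (by linear_combination h) (by ring)
    have h3 : n₁ v = 0 := by simpa using h1.2
    have h4 : n₁ (p v) = 0 := by simpa using h2.2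
    have := (hcomb v 1 0 (by simp [h3]) (by simp [h4])).1
    exact one_ne_zero this
  have hnz : ∀ v, n₂ v = 0 → n₁ v ≠ 0 := by
    intro v h1 h2; apply hcross v; rw [h1, h2]; ring
  have hdisj : ∀ v, n₂ v ≠ 0 → n₁ v = 0 := by
    let m : V → ℚ := fun v => if n₂ v = 0 then n₁ v else 0
    have hm : T *ᵥ m = 0 := by
      ext i
      simp only [mulVec, dotProduct, Pi.zero_apply]
      by_cases hi : n₂ i = 0
      · refine Eq.trans (Finset.sum_congr rfl fun j _ => ?_) (congrFun hn₁ i)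
        by_cases hij : T i j = 0
        · simp [hij]
        · have := hpar _ _ (hTH _ _ hij)
          rw [hi, mul_zero] at this
          simp [m, (mul_eq_zero.1 this).resolve_left (hnz i hi)]
      · refine Finset.sum_eq_zero fun j _ => ?_
        by_cases hij : T i j = 0
        · simp [hij]
        by_cases hj : n₂ j = 0
        · have := hpar _ _ (hTH _ _ hij)
          rw [hj, mul_zero] at this
          exact absurd ((mul_eq_zero.1 this.symm).resolve_right hi) (hnz j hj)
        · simp [m, hj]
    have hma : m a = 1 := by simp [m, h2a, h1a]
    have hmb : m (p a) = 0 := by simp [m, h2b]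
    have := hspan m hm
    rw [hma, hmb, one_smul, zero_smul, add_zero] at this
    intro v hv
    rw [← this]; simp [m, hv]
  have hu : ∀ v, n₁ v + n₂ v ≠ 0 := by
    intro v
    by_cases hv : n₂ v = 0
    · simpa [hv] using hnz v hv
    · simpa [hdisj v hv] using hv
  have hSm : ∀ y, (Matrix.of fun i j => (n₁ i + n₂ i) * T i j * (n₁ j + n₂ j)) *ᵥ y
      = fun i => (n₁ i + n₂ i) * (T *ᵥ fun j => (n₁ j + n₂ j) * y j) i := by
    intro y; ext i
    simp only [mulVec, dotProduct, Matrix.of_apply, Finset.mul_sum]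
    exact Finset.sum_congr rfl fun j _ => by ring
  have hSH : ∀ i j, (Matrix.of fun i j => (n₁ i + n₂ i) * T i j * (n₁ j + n₂ j)) i j ≠ 0 →
      H i j := fun i j h => hTH _ _ fun h' => h (by simp [h'])
  refine ⟨Matrix.of fun i j => (n₁ i + n₂ i) * T i j * (n₁ j + n₂ j),
    fun v => if n₂ v = 0 then 1 else -1, ?_, hSH, ?_, ?_, ?_, ?_, ?_⟩
  · intro i j; simp only [Matrix.of_apply, hT i j]; ring
  · intro i; by_cases h : n₂ i = 0 <;> simp [h]
  · intro v
    by_cases h1 : n₂ v = 0 <;> by_cases h2 : n₂ (p v) = 0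
    · exact absurd (by rw [h1, h2]; ring) (hcross v)
    · simp [h1, h2]
    · simp [h1, h2]
    · exact absurd (by rw [hdisj _ h1, hdisj _ h2]; ring) (hcross v)
  · intro i j hij
    have := hpar _ _ (hSH _ _ hij)
    by_cases h1 : n₂ i = 0 <;> by_cases h2 : n₂ j = 0
    · simp [h1, h2]
    · rw [h1, mul_zero] at this; simp [h2, hnz i h1] at this
    · rw [h2, mul_zero] at this
      rcases mul_eq_zero.1 this.symm with h | h
      · exact absurd h (hnz j h2)
      · exact absurd h h1
    · simp [h1, h2]
  · rw [hSm]
    have : T *ᵥ (fun j => (n₁ j + n₂ j) * (1 : V → ℚ) j) = 0 := by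
      have h : (fun j => (n₁ j + n₂ j) * (1 : V → ℚ) j) = n₁ + n₂ := by ext; simp
      rw [h, mulVec_add, hn₁, hn₂, add_zero]
    rw [this]; ext; simp
  · intro y hy
    rw [hSm] at hy
    have h1 : T *ᵥ (fun j => (n₁ j + n₂ j) * y j) = 0 := by
      ext i
      have := congrFun hy i
      simpa [hu i] using this
    have h2 := hspan _ h1
    refine ⟨(y a + y (p a)) / 2, (y a - y (p a)) / 2, ?_⟩
    ext v
    have h3 := congrFun h2 v
    simp only [h1a, h1b, h2a, h2b, Pi.add_apply, Pi.smul_apply, smul_eq_mul] at h3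
    apply mul_left_cancel₀ (hu v)
    rw [h3]
    by_cases hv : n₂ v = 0
    · simp [hv]; ring
    · simp [hv, hdisj v hv]; ring

end

theorem mem_of_forall_dotProduct {K m : Type*} [Field K] [Fintype m]
    (P : Submodule K (m → K)) (y : m → K)
    (h : ∀ x, (∀ q ∈ P, x ⬝ᵥ q = 0) → x ⬝ᵥ y = 0) : y ∈ P := by
  classical
  by_contra hy
  obtain ⟨f, hf, hfr⟩ := Submodule.exists_dual_map_eq_bot_of_notMem hy inferInstance
  have hfe : ∀ z, f z = (fun i => f (Pi.single i 1)) ⬝ᵥ z := by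
    intro z
    conv_lhs => rw [pi_eq_sum_univ' z]
    simp [dotProduct, map_sum, mul_comm]
  refine hf ?_
  rw [hfe]
  refine h _ fun q hq => ?_
  rw [← hfe]
  have : f q ∈ P.map f := ⟨q, hq, rfl⟩
  rw [hfr] at this
  exact (Submodule.mem_bot K).1 this

theorem exists_mulVec_eq_of_forall_dotProduct {K m n : Type*} [Field K] [Fintype m] [Fintype n]
    (A : Matrix m n K) (y : m → K) (h : ∀ x, Aᵀ *ᵥ x = 0 → x ⬝ᵥ y = 0) : ∃ x, A *ᵥ x = y := by
  refine mem_of_forall_dotProduct (LinearMap.range A.mulVecLin) y fun x hx => h x ?_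
  apply dotProduct_eq_zero _ fun z => ?_
  rw [mulVec_transpose, ← dotProduct_mulVec]
  exact hx _ ⟨z, rfl⟩

section
variable {K V : Type*} [Field K] [Fintype V]

theorem mul_dotProduct_comm (ε x y : V → K) : (ε * x) ⬝ᵥ y = x ⬝ᵥ (ε * y) := by
  simp only [dotProduct, Pi.mul_apply]
  exact Finset.sum_congr rfl fun i _ => by ring

theorem mulVec_mul_of_commute {T : Matrix V V K} {ε : V → K}
    (h : ∀ i j, T i j ≠ 0 → ε i = ε j) (y : V → K) : T *ᵥ (ε * y) = ε * (T *ᵥ y) := by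
  ext i
  simp only [mulVec, dotProduct, Pi.mul_apply, Finset.mul_sum]
  refine Finset.sum_congr rfl fun j _ => ?_
  by_cases hij : T i j = 0
  · simp [hij]
  · rw [h i j hij]; ring

theorem mulVec_mul_of_anticommute {D : Matrix V V K} {ε : V → K}
    (h : ∀ i j, D i j ≠ 0 → ε i = - ε j) (y : V → K) : D *ᵥ (ε * y) = - (ε * (D *ᵥ y)) := by
  ext i
  simp only [mulVec, dotProduct, Pi.mul_apply, Finset.mul_sum, Pi.neg_apply, ← Finset.sum_neg_distrib]
  refine Finset.sum_congr rfl fun j _ => ?_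
  by_cases hij : D i j = 0
  · simp [hij]
  · rw [h i j hij]; ring

theorem coeff_pencil_zero (T D : Matrix V V K) (v : V → K[X]) (i : V) :
    (((T.map C + (X : K[X]) • D.map C) *ᵥ v) i).coeff 0 = (T *ᵥ fun j => (v j).coeff 0) i := by
  simp only [mulVec, dotProduct, finsetSum_coeff, Matrix.add_apply, Matrix.smul_apply,
    Matrix.map_apply, add_mul, smul_eq_mul, mul_assoc, coeff_add, coeff_C_mul, coeff_X_mul_zero,
    add_zero]

theorem coeff_pencil_succ (T D : Matrix V V K) (v : V → K[X]) (i : V) (n : ℕ) :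
    (((T.map C + (X : K[X]) • D.map C) *ᵥ v) i).coeff (n + 1)
      = (T *ᵥ fun j => (v j).coeff (n + 1)) i + (D *ᵥ fun j => (v j).coeff n) i := by
  simp only [mulVec, dotProduct, finsetSum_coeff, Matrix.add_apply, Matrix.smul_apply,
    Matrix.map_apply, add_mul, smul_eq_mul, mul_assoc, coeff_add, coeff_C_mul, coeff_X_mul,
    Finset.sum_add_distrib]

end

section
variable {V : Type*} [Fintype V] {T D : Matrix V V ℚ} {ε σ : V → ℚ}

theorem skew_dotProduct_mul_self (hT : ∀ i j, T j i = - T i j)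
    (hTε : ∀ i j, T i j ≠ 0 → ε i = ε j) : σ ⬝ᵥ (ε * (T *ᵥ σ)) = 0 := by
  have := skew_dotProduct hT σ (ε * σ)
  rw [mulVec_mul_of_commute hTε, dotProduct_comm (T *ᵥ σ), mul_dotProduct_comm] at this
  exact self_eq_neg.mp this

theorem exists_mulVec_eq_of_ker (hT : ∀ i j, T j i = - T i j)
    (hker : ∀ y, T *ᵥ y = 0 → ∃ α β : ℚ, y = α • 1 + β • ε) {y : V → ℚ}
    (h1 : 1 ⬝ᵥ y = 0) (h2 : ε ⬝ᵥ y = 0) : ∃ x, T *ᵥ x = y := by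
  apply exists_mulVec_eq_of_forall_dotProduct
  have : Tᵀ = -T := by ext i j; exact hT i j
  intro x hx
  rw [this, neg_mulVec, neg_eq_zero] at hx
  obtain ⟨α, β, rfl⟩ := hker x hx
  simp [add_dotProduct, smul_dotProduct, h1, h2]

variable [DecidableEq V]

theorem det_pencil_eq_zero [Nonempty V] (hT : ∀ i j, T j i = - T i j)
    (hTε : ∀ i j, T i j ≠ 0 → ε i = ε j) (hT1 : T *ᵥ 1 = 0)
    (hker : ∀ y, T *ᵥ y = 0 → ∃ α β : ℚ, y = α • 1 + β • ε)
    (hD : ∀ i j, D j i = - D i j) (hDε : ∀ i j, D i j ≠ 0 → ε i = - ε j)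
    (hdet : ∃ c, (T.map C + (X : ℚ[X]) • D.map C).det = C c * X ^ 2)
    (hσ : T *ᵥ σ = D *ᵥ 1) : (T.map C + (X : ℚ[X]) • D.map C).det = 0 := by
  have hDe : D *ᵥ ε = - (ε * (D *ᵥ 1)) := by
    rw [← mulVec_mul_of_anticommute hDε, mul_one]
  obtain ⟨τ, hτ⟩ : ∃ τ, T *ᵥ τ = D *ᵥ σ := by
    apply exists_mulVec_eq_of_ker hT hker
    · rw [skew_dotProduct hD, ← hσ, dotProduct_comm, skew_dotProduct_self hT, neg_zero]
    · rw [skew_dotProduct hD, hDe, ← hσ, dotProduct_comm, dotProduct_neg,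
        skew_dotProduct_mul_self hT hTε, neg_zero, neg_zero]
  obtain ⟨c, hc⟩ := hdet
  set w : V → ℚ[X] := fun i => 1 - C (σ i) * X + C (τ i) * X ^ 2 with hw
  have hw0 : (fun j => (w j).coeff 0) = 1 := by ext j; simp [hw]
  have hw1 : (fun j => (w j).coeff 1) = -σ := by ext j; simp [hw, coeff_one, coeff_X_pow]
  have hw2 : (fun j => (w j).coeff 2) = τ := by ext j; simp [hw, coeff_one]
  have hdvd : ∀ i, X ^ 3 ∣ ((T.map C + (X : ℚ[X]) • D.map C) *ᵥ w) i := by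
    intro i
    rw [X_pow_dvd_iff]
    intro d hd
    interval_cases d
    · rw [coeff_pencil_zero, hw0, hT1]; rfl
    · rw [coeff_pencil_succ, hw0, hw1, mulVec_neg, hσ]; simp
    · rw [coeff_pencil_succ, hw1, hw2, mulVec_neg, hτ]; simp
  obtain ⟨i⟩ := ‹Nonempty V›
  have hadj := congrFun (congrArg (fun M => M *ᵥ w)
    (adjugate_mul (T.map C + (X : ℚ[X]) • D.map C))) i
  simp only [← mulVec_mulVec, smul_mulVec, one_mulVec, hc, Pi.smul_apply, smul_eq_mul] at hadj
  have hd3 : X ^ 3 ∣ C c * X ^ 2 * w i := by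
    rw [← hadj]
    exact Finset.dvd_sum fun j _ => Dvd.dvd.mul_left (hdvd j) _
  have := X_pow_dvd_iff.1 hd3 2 (by norm_num)
  rw [mul_assoc, coeff_C_mul, coeff_X_pow_mul'] at this
  have h0 := congrFun hw0 i
  simp only [Pi.one_apply] at h0
  simp [h0] at this
  rw [hc, this]; simp

theorem dotProduct_mul_pencil_eq_zero [Nonempty V] (hT : ∀ i j, T j i = - T i j)
    (hε : ∀ i, ε i = 1 ∨ ε i = -1)
    (hTε : ∀ i j, T i j ≠ 0 → ε i = ε j) (hT1 : T *ᵥ 1 = 0)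
    (hker : ∀ y, T *ᵥ y = 0 → ∃ α β : ℚ, y = α • 1 + β • ε)
    (hD : ∀ i j, D j i = - D i j) (hDε : ∀ i j, D i j ≠ 0 → ε i = - ε j)
    (hdet : ∃ c, (T.map C + (X : ℚ[X]) • D.map C).det = C c * X ^ 2)
    (hσ : T *ᵥ σ = D *ᵥ 1) : σ ⬝ᵥ (ε * (D *ᵥ σ)) = 0 := by
  have hεε : ∀ y : V → ℚ, ε * (ε * y) = y := by
    intro y; ext i
    rcases hε i with h | h <;> simp [h]
  have hDe : D *ᵥ ε = - (T *ᵥ (ε * σ)) := by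
    rw [mulVec_mul_of_commute hTε, hσ, ← mulVec_mul_of_anticommute hDε, mul_one]
  have hc := mulVec_mul_of_commute hTε
  have ha := mulVec_mul_of_anticommute hDε
  obtain ⟨v, hv0, hv⟩ := exists_mulVec_eq_zero_iff.2
    (det_pencil_eq_zero hT hTε hT1 hker hD hDε hdet hσ)
  have hex : ∃ k, (fun j => (v j).coeff k) ≠ 0 := by
    by_contra! h
    exact hv0 (by ext j k; simpa using congrFun (h k) j)
  have hsucc : ∀ n, T *ᵥ (fun j => (v j).coeff (n + 1)) = - (D *ᵥ fun j => (v j).coeff n) := by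
    intro n; ext i
    have := coeff_pencil_succ T D v i n
    rw [hv] at this
    simp only [Pi.zero_apply, coeff_zero] at this
    simp only [Pi.neg_apply]; linarith
  classical
  obtain ⟨k, hk, hmin⟩ : ∃ k, (fun j => (v j).coeff k) ≠ 0 ∧
      ∀ l < k, (fun j => (v j).coeff l) = 0 :=
    ⟨Nat.find hex, Nat.find_spec hex, fun l hl => by simpa using Nat.find_min hex hl⟩
  have hk0 : T *ᵥ (fun j => (v j).coeff k) = 0 := by
    rcases k with _ | k
    · ext i; rw [← coeff_pencil_zero T D, hv]; simp
    · rw [hsucc, hmin k (by omega), mulVec_zero, neg_zero]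
  have s1 := hsucc k
  have s2 := hsucc (k + 1)
  have s3 := hsucc (k + 1 + 1)
  generalize (fun j => (v j).coeff k) = v0 at *
  generalize (fun j => (v j).coeff (k + 1)) = v1 at *
  generalize (fun j => (v j).coeff (k + 1 + 1)) = v2 at *
  generalize (fun j => (v j).coeff (k + 1 + 1 + 1)) = v3 at *
  obtain ⟨α, β, rfl⟩ := hker v0 hk0
  obtain ⟨γ, δ, h1⟩ := hker (v1 + α • σ - β • (ε * σ)) (by
    rw [mulVec_sub, mulVec_add, mulVec_smul, mulVec_smul, s1, mulVec_add, mulVec_smul, mulVec_smul,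
      hDe, hσ, smul_neg]
    abel)
  have h1' : v1 = γ • 1 + δ • ε - α • σ + β • (ε * σ) := by rw [← h1]; abel
  have hTe : T *ᵥ ε = 0 := by rw [← mul_one ε, hc, hT1, mul_zero]
  have q1 : σ ⬝ᵥ D *ᵥ σ = 0 := skew_dotProduct_self hD σ
  have q2 : σ ⬝ᵥ T *ᵥ σ = 0 := skew_dotProduct_self hT σ
  have q3 : σ ⬝ᵥ (ε * (T *ᵥ σ)) = 0 := skew_dotProduct_mul_self hT hTε
  have hDv1 : D *ᵥ v1 = γ • (T *ᵥ σ) - δ • (ε * (T *ᵥ σ)) - α • (D *ᵥ σ)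
      - β • (ε * (D *ᵥ σ)) := by
    rw [h1', mulVec_add, mulVec_sub, mulVec_add, mulVec_smul, mulVec_smul, mulVec_smul,
      mulVec_smul, ha, hDe, hσ, hc, hσ, smul_neg, smul_neg]
    abel
  have r1 : (1 : V → ℚ) ⬝ᵥ D *ᵥ v2 = 0 := by
    rw [← neg_eq_iff_eq_neg.2 s3, dotProduct_neg, skew_dotProduct hT, hT1]; simp
  have r2 : ε ⬝ᵥ D *ᵥ v2 = 0 := by
    rw [← neg_eq_iff_eq_neg.2 s3, dotProduct_neg, skew_dotProduct hT, hTe]; simp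
  rw [skew_dotProduct hD, ← hσ, ← skew_dotProduct hT, s2, hDv1] at r1
  rw [skew_dotProduct hD, hDe, neg_dotProduct, neg_neg, ← neg_eq_zero, ← skew_dotProduct hT, s2,
    hDv1, dotProduct_neg, mul_dotProduct_comm] at r2
  simp only [mul_sub, mul_smul_comm, hεε, dotProduct_neg, dotProduct_sub, dotProduct_smul, q1, q2,
    q3, smul_eq_mul, mul_zero, sub_zero, zero_sub, neg_neg] at r1 r2
  by_contra hκ
  have hα : α = 0 := by simpa [hκ] using r2
  have hβ : β = 0 := by simpa [hκ] using r1
  exact hk (by simp [hα, hβ])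

end

theorem exists_iterate_mem_periodicPts {α : Type*} [Finite α] (f : α → α) (x : α) :
    ∃ n, f^[n] x ∈ Function.periodicPts f := by
  obtain ⟨m, n, hmn, h⟩ := Finite.exists_ne_map_eq_of_infinite fun n : ℕ => f^[n] x
  wlog hlt : m < n generalizing m n
  · exact this n m hmn.symm h.symm (by omega)
  refine ⟨m, Function.mk_mem_periodicPts (n := n - m) (by omega) ?_⟩
  change f^[n - m] (f^[m] x) = f^[m] x
  rw [← Function.iterate_add_apply, Nat.sub_add_cancel hlt.le]
  exact h.symm

theorem finrank_range_lt_of_apply_eq_zero {K M W : Type*} [Field K] [AddCommGroup M] [Module K M]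
    [FiniteDimensional K M] [AddCommGroup W] [Module K W] (f : M →ₗ[K] W) {x : M} (hx : x ≠ 0)
    (hfx : f x = 0) : Module.finrank K (LinearMap.range f) < Module.finrank K M := by
  have h1 := LinearMap.finrank_range_add_finrank_ker f
  have h2 : 0 < Module.finrank K (LinearMap.ker f) :=
    Module.finrank_pos_iff_exists_ne_zero.2 ⟨⟨x, hfx⟩, fun h => hx (congrArg Subtype.val h)⟩
  omega

theorem finrank_le_two_mul_of_injective {K M W : Type*} [Field K] [AddCommGroup M] [Module K M]
    [FiniteDimensional K M] [AddCommGroup W] [Module K W] (P : Submodule K W)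
    [FiniteDimensional K P] (F : M →ₗ[K] Module.Dual K P) (g : M →ₗ[K] W)
    (hg : ∀ x, g x = 0 → x = 0) (hFg : ∀ x, F x = 0 → g x ∈ P) :
    Module.finrank K M ≤ 2 * Module.finrank K P := by
  have c1 := LinearMap.finrank_le_finrank_of_injective
    (f := (g ∘ₗ (LinearMap.ker F).subtype).codRestrict P fun x => hFg _ x.2)
    ((injective_iff_map_eq_zero _).2 fun x hx =>
      Subtype.ext (hg _ (congrArg Subtype.val hx)))
  have c2 := LinearMap.finrank_range_add_finrank_ker F
  have c3 := Submodule.finrank_le (LinearMap.range F)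
  rw [Subspace.dual_finrank_eq] at c3
  omega

/-- The space of functions invariant under `p`. -/
def invariantFunctions {V : Type*} (K : Type*) [Field K] (p : V → V) : Submodule K (V → K) where
  carrier := {h | ∀ v, h (p v) = h v}
  add_mem' ha hb v := by simp [ha v, hb v]
  zero_mem' v := rfl
  smul_mem' c h hh v := by simp [hh v]

section
variable {V : Type*} [DecidableEq V]

/-- The skew-symmetric matrix `∑ v, g v • skewUnit v (p v)`. -/
def pairMatrix {K : Type*} [Field K] (p : V → V) (g : V → K) : Matrix V V K :=
  fun i j => (if p i = j then g i else 0) - if p j = i then g j else 0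

variable {p : V → V}

theorem pairMatrix_neg {K : Type*} [Field K] (g : V → K) (i j : V) :
    pairMatrix p g j i = - pairMatrix p g i j := by
  simp [pairMatrix]

theorem pairMatrix_ne_zero {K : Type*} [Field K] {g : V → K} {i j : V}
    (h : pairMatrix p g i j ≠ 0) : p i = j ∨ p j = i := by
  by_contra! h'
  simp [pairMatrix, h'.1, h'.2] at h

theorem pairMatrix_add {K : Type*} [Field K] (g g' : V → K) :
    pairMatrix p (g + g') = pairMatrix p g + pairMatrix p g' := by
  ext i j
  simp only [pairMatrix, Pi.add_apply, Matrix.add_apply]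
  split_ifs <;> ring

theorem pairMatrix_mulVec [Fintype V] {K : Type*} [Field K] (g y : V → K) (x : V) :
    (pairMatrix p g *ᵥ y) x = g x * y (p x) - ∑ w, if p w = x then g w * y w else 0 := by
  simp [pairMatrix, mulVec, dotProduct, sub_mul, Finset.sum_sub_distrib, ite_mul]

theorem exists_minimal_determining [Fintype V] {ε : V → ℚ} (hε : ∀ i, ε i = 1 ∨ ε i = -1)
    (hp : ∀ v, ε (p v) = - ε v) (hpp : ∀ v, p (p v) ≠ v) :
    ∃ I : Finset V, (∀ i ∈ I, i ∈ Function.periodicPts p ∧ ε i = 1) ∧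
      (∀ h ∈ invariantFunctions ℚ p, (∀ i ∈ I, h i = 0) → h = 0) ∧ ∀ i ∈ I, p (p i) ∉ I := by
  classical
  obtain ⟨I, ⟨h1, h2⟩, hmin⟩ := exists_minimal_of_wellFoundedLT (fun I : Finset V =>
    (∀ i ∈ I, i ∈ Function.periodicPts p ∧ ε i = 1) ∧
      (∀ h ∈ invariantFunctions ℚ p, (∀ i ∈ I, h i = 0) → h = 0))
    ⟨Finset.univ.filter fun i => i ∈ Function.periodicPts p ∧ ε i = 1, by simp, by
      intro h hh h0
      have hit : ∀ n v, h (p^[n] v) = h v := by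
        intro n v
        induction n with
        | zero => rfl
        | succ n ih => rw [Function.iterate_succ_apply', hh, ih]
      ext v
      obtain ⟨n, hn⟩ := exists_iterate_mem_periodicPts p v
      rcases hε (p^[n] v) with h1 | h1
      · rw [← hit n v]; exact h0 _ (by simp [hn, h1])
      · rw [← hit n v, ← hh]
        exact h0 _ (by
          simp [hp, h1, (Function.bijOn_periodicPts p).mapsTo hn])⟩
  refine ⟨I, h1, h2, fun i hi hpi => ?_⟩
  have hle : I ≤ I.erase (p (p i)) := hmin (y := I.erase (p (p i)))
    ⟨fun j hj => h1 j (Finset.mem_of_mem_erase hj), fun h hh h0 => h2 h hh fun j hj => by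
      by_cases hj' : j = p (p i)
      · rw [hj', hh, hh]
        exact h0 i (Finset.mem_erase.2 ⟨(hpp i).symm, hi⟩)
      · exact h0 j (Finset.mem_erase.2 ⟨hj', hj⟩)⟩ (Finset.erase_subset _ _)
  exact Finset.notMem_erase _ _ (hle hpi)

open scoped Classical in
theorem pairMatrix_periodicPts_mulVec [Fintype V] (η : V → ℚ) {x : V}
    (hx : x ∈ Function.periodicPts p) :
    (pairMatrix p (fun v => if v ∈ Function.periodicPts p then (1 : ℚ) else 0) *ᵥ η) (p x)
      = η (p (p x)) - η x := by
  have hb := Function.bijOn_periodicPts p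
  rw [pairMatrix_mulVec, if_pos (hb.mapsTo hx), one_mul, Finset.sum_eq_single x]
  · simp [hx]
  · intro w _ hw
    by_cases hw' : w ∈ Function.periodicPts p
    · rw [if_neg fun h => hw (hb.injOn hw' hx h)]
    · simp [hw']
  · simp

open scoped Classical in
theorem pairMatrix_periodicPts_mulVec_one [Fintype V] :
    pairMatrix p (fun v => if v ∈ Function.periodicPts p then (1 : ℚ) else 0) *ᵥ 1 = 0 := by
  have hb := Function.bijOn_periodicPts p
  ext x
  by_cases hx : x ∈ Function.periodicPts p
  · obtain ⟨y, hy, rfl⟩ := hb.surjOn hx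
    rw [pairMatrix_periodicPts_mulVec _ hy]; simp
  · rw [pairMatrix_mulVec, if_neg hx, Finset.sum_eq_zero]
    · simp
    · intro w _
      by_cases hw : w ∈ Function.periodicPts p
      · rw [if_neg fun h : p w = x => hx (h ▸ hb.mapsTo hw)]
      · simp [hw]

theorem false_of_pencil_condition [Fintype V] [Nonempty V] {ε : V → ℚ}
    (hε : ∀ i, ε i = 1 ∨ ε i = -1)
    (hp : ∀ v, ε (p v) = - ε v) (hpp : ∀ v, p (p v) ≠ v) {T : Matrix V V ℚ}
    (hT : ∀ i j, T j i = - T i j) (hT1 : T *ᵥ 1 = 0)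
    (hQ : ∀ g σ, T *ᵥ σ = pairMatrix p g *ᵥ 1 → σ ⬝ᵥ (ε * (pairMatrix p g *ᵥ σ)) = 0) :
    False := by
  classical
  obtain ⟨I, hI1, hI2, hI3⟩ := exists_minimal_determining hε hp hpp
  set N := invariantFunctions ℚ p with hN
  let P : Submodule ℚ (V → ℚ) := LinearMap.range (T.mulVecLin ∘ₗ N.subtype)
  have hP : Module.finrank ℚ P < Module.finrank ℚ N := by
    refine finrank_range_lt_of_apply_eq_zero _ (x := ⟨1, fun v => rfl⟩) (fun h => ?_) hT1
    have := congrFun (congrArg Subtype.val h) (Classical.arbitrary V)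
    simp at this
  set Z := pairMatrix p (fun v => if v ∈ Function.periodicPts p then (1 : ℚ) else 0) with hZ
  have hanti : ∀ g : V → ℚ, ∀ i j, pairMatrix p g i j ≠ 0 → ε i = - ε j := by
    intro g i j h
    rcases pairMatrix_ne_zero h with rfl | rfl
    · rw [hp, neg_neg]
    · rw [hp]
  have hS : ∀ σ, (∀ q ∈ P, σ ⬝ᵥ q = 0) → σ ⬝ᵥ (ε * (Z *ᵥ σ)) = 0 := by
    intro σ hσ
    obtain ⟨g, hg⟩ := exists_mulVec_eq_of_forall_dotProduct
      (Matrix.of fun x w => (if x = w then (1 : ℚ) else 0) - if p w = x then 1 else 0)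
      (T *ᵥ σ) (by
        intro h hh
        have hinv : h ∈ N := by
          intro v
          have := congrFun hh v
          simp [mulVec, dotProduct, sub_mul, Finset.sum_sub_distrib] at this
          linarith
        rw [skew_dotProduct hT, dotProduct_comm, hσ (T *ᵥ h) ⟨⟨h, hinv⟩, rfl⟩, neg_zero])
    have hg' : T *ᵥ σ = pairMatrix p g *ᵥ 1 := by
      rw [← hg]; ext x
      rw [pairMatrix_mulVec]
      simp [mulVec, dotProduct, sub_mul, Finset.sum_sub_distrib]
    have e1 := hQ g σ hg'
    have e2 := hQ (g + fun v => if v ∈ Function.periodicPts p then (1 : ℚ) else 0) σ (by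
      rw [pairMatrix_add, add_mulVec, pairMatrix_periodicPts_mulVec_one, add_zero, hg'])
    rw [pairMatrix_add, add_mulVec, mul_add, dotProduct_add, e1, zero_add] at e2
    exact e2
  have hsymm : ∀ x y, x ⬝ᵥ (ε * (Z *ᵥ y)) = y ⬝ᵥ (ε * (Z *ᵥ x)) := by
    intro x y
    rw [← mul_dotProduct_comm, skew_dotProduct (pairMatrix_neg _),
      mulVec_mul_of_anticommute (hanti _), neg_dotProduct, neg_neg, dotProduct_comm]
  have hmem : ∀ σ, (∀ q ∈ P, σ ⬝ᵥ q = 0) → ε * (Z *ᵥ σ) ∈ P := by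
    intro σ hσ
    refine mem_of_forall_dotProduct P _ fun x hx => ?_
    have := hS (σ + x) fun q hq => by rw [add_dotProduct, hσ q hq, hx q hq, add_zero]
    rw [mulVec_add, mul_add, add_dotProduct, dotProduct_add, dotProduct_add, hS σ hσ, hS x hx,
      hsymm σ x] at this
    linarith
  let J : (N × N) →ₗ[ℚ] (V → ℚ) :=
    { toFun := fun h x => (if x ∈ I then h.1.1 x else 0) + if x ∈ I.image p then h.2.1 x else 0
      map_add' := by
        intro h h'; ext x
        simp only [Prod.fst_add, Prod.snd_add, Submodule.coe_add, Pi.add_apply]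
        split_ifs <;> ring
      map_smul' := by
        intro c h; ext x
        simp only [Prod.smul_fst, Prod.smul_snd, SetLike.val_smul, Pi.smul_apply, smul_eq_mul,
          RingHom.id_apply]
        split_ifs <;> ring }
  have hJ : ∀ h x, J h x = (if x ∈ I then h.1.1 x else 0)
    + if x ∈ I.image p then h.2.1 x else 0 := fun _ _ => rfl
  have hsgn : ∀ x ∈ I.image p, ε x = -1 := by
    intro x hx
    obtain ⟨i, hi, rfl⟩ := Finset.mem_image.1 hx
    rw [hp, (hI1 i hi).2]
  have hJinj : ∀ h, ε * (Z *ᵥ J h) = 0 → h = 0 := by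
    intro h h0
    have hper : ∀ r ∈ Function.periodicPts p, J h (p (p r)) = J h r := by
      intro r hr
      have := congrFun h0 (p r)
      rw [Pi.mul_apply, pairMatrix_periodicPts_mulVec _ hr, Pi.zero_apply] at this
      rcases hε (p r) with h1 | h1 <;> rw [h1] at this <;> linarith
    have hb := Function.bijOn_periodicPts p
    have z1 : h.1.1 = 0 := by
      refine hI2 _ h.1.2 fun i hi => ?_
      have := hper i (hI1 i hi).1
      rw [hJ, hJ, if_neg (hI3 i hi), if_pos hi, if_neg, if_neg] at this
      · linarith
      · intro h1; have := hsgn _ h1; rw [(hI1 i hi).2] at this; norm_num at this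
      · intro h1; have := hsgn _ h1; rw [hp, hp, (hI1 i hi).2] at this; norm_num at this
    have z2 : h.2.1 = 0 := by
      refine hI2 _ h.2.2 fun i hi => ?_
      have := hper (p i) (hb.mapsTo (hI1 i hi).1)
      rw [hJ, hJ, if_neg, if_neg, if_neg, if_pos (Finset.mem_image_of_mem p hi),
        h.2.2] at this
      · linarith
      · intro h1; have := (hI1 _ h1).2; rw [hp, (hI1 i hi).2] at this; norm_num at this
      · intro h1
        obtain ⟨j, hj, hj'⟩ := Finset.mem_image.1 h1
        rw [hb.injOn (hI1 j hj).1 (hb.mapsTo (hb.mapsTo (hI1 i hi).1)) hj'] at hj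
        exact hI3 i hi hj
      · intro h1; have := (hI1 _ h1).2; rw [hp, hp, hp, (hI1 i hi).2] at this; norm_num at this
    exact Prod.ext (Subtype.ext z1) (Subtype.ext z2)
  let F : (N × N) →ₗ[ℚ] Module.Dual ℚ P :=
    { toFun := fun h => (dotProductBilin ℚ ℚ (J h)) ∘ₗ P.subtype
      map_add' := by intro h h'; ext q; simp
      map_smul' := by intro c h; ext q; simp }
  have hF : ∀ h, F h = 0 → ∀ q ∈ P, J h ⬝ᵥ q = 0 := fun h hh q hq =>
    congrArg (fun φ => φ ⟨q, hq⟩) hh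
  let G : (N × N) →ₗ[ℚ] (V → ℚ) :=
    { toFun := fun h => ε * (Z *ᵥ J h)
      map_add' := by intro h h'; simp [mulVec_add, mul_add]
      map_smul' := by intro c h; ext q; simp [mulVec_smul]; ring }
  have := finrank_le_two_mul_of_injective P F G hJinj fun h hh => hmem _ (hF h hh)
  rw [Module.finrank_prod] at this
  omega

end

theorem false_of_forall_matching_two {V : Type*} [Fintype V] {H B : V → V → Prop}
    (hHs : ∀ i j, H i j → H j i) (hBs : ∀ i j, B i j → B j i) (hHB : ∀ i j, H i j → ¬ B i j)
    (hHne : ∀ u, ¬ H u u) {p : V → V} (hBp : ∀ v, B v (p v)) (hpne : ∀ v, p v ≠ v)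
    (hpp : ∀ v, p (p v) ≠ v)
    (hPM : ∀ f : V → V, Function.Involutive f → (∀ v, H v (f v) ∨ B v (f v)) →
      {v | B v (f v)}.ncard = 2)
    (hcov : ∀ u, ∃ f : V → V, Function.Involutive f ∧ (∀ v, H v (f v) ∨ B v (f v)) ∧
      f u = p u) : False := by
  classical
  have hV : Nonempty V := by
    by_contra h
    rw [not_nonempty_iff] at h
    have := hPM id (fun v => rfl) fun v => isEmptyElim v
    simp [Set.eq_empty_of_isEmpty] at this
  have hsing : ∀ S : Matrix V V ℚ, (∀ i j, S j i = - S i j) → (∀ i j, S i j ≠ 0 → H i j) →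
      S.det = 0 := by
    intro S hS hSH
    obtain ⟨c, hc⟩ := det_add_X_smul hBs hHB hPM hS (D := 0) (by simp) hSH (by simp)
    have e : S.map C + (X : ℚ[X]) • (0 : Matrix V V ℚ).map C = C.mapMatrix S := by
      ext1 i j; simp
    rw [e, ← RingHom.map_det] at hc
    have := congrArg (fun q => coeff q 0) hc
    simpa using this
  obtain ⟨T, hT, hTH, hd⟩ := exists_skew_forall_det_ne_zero hHs hHne p
    (fun v h => hHB _ _ h (hBp v)) hpne (by
      intro v
      obtain ⟨f, hf, hfm, hfv⟩ := hcov v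
      refine ⟨f, hf, hfv, fun u hu hu' => (hfm u).resolve_right fun hB => ?_⟩
      have hsub : ((({v, f v, u} : Finset V)) : Set V) ⊆ {v | B v (f v)} := by
        intro x hx
        simp only [Finset.coe_insert, Finset.coe_singleton, Set.mem_insert_iff,
          Set.mem_singleton_iff] at hx
        rcases hx with rfl | rfl | rfl
        · simpa [hfv] using hBp x
        · change B (f v) (f (f v))
          rw [hf v, hfv]
          exact hBs _ _ (hBp v)
        · exact hB
      have := Set.ncard_le_ncard hsub (Set.toFinite _)
      rw [Set.ncard_coe_finset, hPM f hf hfm, Finset.card_eq_three.2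
        ⟨v, f v, u, by rw [hfv]; exact (hpne v).symm, hu.symm, hu'.symm, rfl⟩] at this
      omega)
  obtain ⟨S, ε, hS, hSH, hε, hεp, hSε, hS1, hker⟩ :=
    exists_signed_of_generic hHs hsing hT hTH hd
  refine false_of_pencil_condition hε hεp hpp hS hS1 fun g σ hσ => ?_
  refine dotProduct_mul_pencil_eq_zero hS hε hSε hS1 hker (pairMatrix_neg g) ?_ ?_ hσ
  · intro i j h
    rcases pairMatrix_ne_zero h with rfl | rfl
    · rw [hεp, neg_neg]
    · rw [hεp]
  · refine det_add_X_smul hBs hHB hPM hS (pairMatrix_neg g) hSH fun i j h => ?_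
    rcases pairMatrix_ne_zero h with rfl | rfl
    · exact hBp _
    · exact hBs _ _ (hBp _)

end

namespace Multigraph

variable {V E : Type} {G : Multigraph V E}

/-- The edge `e` has endpoints `a` and `b`. -/
def Joins (G : Multigraph V E) (e : E) (a b : V) : Prop :=
  (G.fst e = a ∧ G.snd e = b) ∨ (G.fst e = b ∧ G.snd e = a)

theorem Joins.symm {e : E} {a b : V} (h : G.Joins e a b) : G.Joins e b a := Or.symm h

theorem Joins.ne {e : E} {a b : V} (h : G.Joins e a b) : a ≠ b := by
  rcases h with ⟨rfl, rfl⟩ | ⟨rfl, rfl⟩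
  · exact G.no_loop e
  · exact (G.no_loop e).symm

theorem Joins.inc {e : E} {a b : V} (h : G.Joins e a b) : G.Inc e a := by
  rcases h with h | h
  · exact Or.inl h.1
  · exact Or.inr h.2

theorem Inc.exists_joins {e : E} {a : V} (h : G.Inc e a) : ∃ b, G.Joins e a b := by
  rcases h with h | h
  · exact ⟨_, Or.inl ⟨h, rfl⟩⟩
  · exact ⟨_, Or.inr ⟨rfl, h⟩⟩

theorem Joins.eq_right {e : E} {a b d : V} (h : G.Joins e a b) (h' : G.Joins e a d) : b = d := by
  have := G.no_loop e
  rcases h with ⟨rfl, rfl⟩ | ⟨rfl, rfl⟩ <;> rcases h' with ⟨h1, h2⟩ | ⟨h1, h2⟩ <;> simp_all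

theorem Joins.parallel {e f : E} {a b : V} (h : G.Joins e a b) (h' : G.Joins f a b) :
    G.Parallel e f := by
  rcases h with ⟨rfl, rfl⟩ | ⟨rfl, rfl⟩ <;> rcases h' with ⟨h1, h2⟩ | ⟨h1, h2⟩ <;>
    simp [Parallel, h1, h2]

theorem IsPerfectMatching.exists_involutive {M : Set E} (hM : G.IsPerfectMatching M) :
    ∃ (f : V → V) (m : V → E), Function.Involutive f ∧ (∀ v, G.Joins (m v) v (f v)) ∧
      ∀ v, ∀ e ∈ M, G.Inc e v → e = m v := by
  choose m hm hu using fun v => hM.2 v (Set.mem_univ v)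
  choose f hf using fun v => (hm v).2.exists_joins
  refine ⟨f, m, fun v => ?_, hf, fun v e he hev => hu v e ⟨he, hev⟩⟩
  have h1 : m v = m (f v) := hu (f v) (m v) ⟨(hm v).1, (hf v).symm.inc⟩
  have h2 := hf (f v)
  rw [← h1] at h2
  exact h2.eq_right (hf v).symm

theorem isPerfectMatching_of_involutive (hs : ∀ e f, G.Parallel e f → e = f) {f : V → V}
    (hf : Function.Involutive f) (h : ∀ v, ∃ e, G.Joins e v (f v)) :
    G.IsPerfectMatching {e | f (G.fst e) = G.snd e} := by
  refine ⟨fun e _ => ⟨Set.mem_univ _, Set.mem_univ _⟩, fun v _ => ?_⟩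
  obtain ⟨e, he⟩ := h v
  refine ⟨e, ⟨?_, he.inc⟩, ?_⟩
  · rcases he with ⟨h1, h2⟩ | ⟨h1, h2⟩
    · simp [h1, h2]
    · simp [h1, h2, hf v]
  · rintro e' ⟨h1, h2⟩
    refine hs _ _ (Joins.parallel (a := v) (b := f v) ?_ he)
    rcases h2 with rfl | rfl
    · exact Or.inl ⟨rfl, h1.symm⟩
    · refine Or.inr ⟨?_, rfl⟩
      rw [← hf (G.fst e'), show f (G.fst e') = G.snd e' from h1]

theorem not_isWState_of_forall_parallel_eq [Fintype V] {c : E → V → Bool}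
    (hs : ∀ e f, G.Parallel e f → e = f) : ¬ G.IsWState c := by
  rintro ⟨hcov, hmat, hver, hmono⟩
  have hred : ∀ v, ∃ w e, G.Joins e v w ∧ G.Bichromatic c e ∧ c e v = true := by
    intro v
    obtain ⟨e, he, hc⟩ := hver v
    obtain ⟨w, hw⟩ := he.exists_joins
    refine ⟨w, e, hw, fun hb => ?_, hc⟩
    have h1 := hmono e (not_not.2 hb)
    have h2 := h1
    rw [hb] at h2
    rcases he with rfl | rfl <;> simp_all
  choose p r hr hrb hrc using hred
  refine false_of_forall_matching_two
    (H := fun a b => ∃ e, G.Joins e a b ∧ ¬ G.Bichromatic c e)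
    (B := fun a b => ∃ e, G.Joins e a b ∧ G.Bichromatic c e) (p := p)
    ?_ ?_ ?_ ?_ ?_ ?_ ?_ ?_ ?_
  · rintro i j ⟨e, he, hb⟩; exact ⟨e, he.symm, hb⟩
  · rintro i j ⟨e, he, hb⟩; exact ⟨e, he.symm, hb⟩
  · rintro i j ⟨e, he, hb⟩ ⟨e', he', hb'⟩
    exact hb (hs _ _ (he.parallel he') ▸ hb')
  · rintro u ⟨e, he, -⟩; exact he.ne rfl
  · exact fun v => ⟨r v, hr v, hrb v⟩
  · exact fun v => (hr v).ne.symm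
  · intro v hv
    have h1 := hr (p v)
    rw [hv] at h1
    have h2 := hs _ _ (h1.parallel (hr v).symm)
    have h3 := hrc (p v)
    rw [h2] at h3
    apply hrb v
    rcases hr v with ⟨h4, h5⟩ | ⟨h4, h5⟩ <;> rw [h4, h5, hrc v, h3]
  · intro f hf hfm
    have hM := isPerfectMatching_of_involutive hs hf fun v => by
      rcases hfm v with ⟨e, he, -⟩ | ⟨e, he, -⟩ <;> exact ⟨e, he⟩
    obtain ⟨e, ⟨he, heb⟩, hu⟩ := hmat _ hM
    have hset : {v | ∃ e, G.Joins e v (f v) ∧ G.Bichromatic c e} = {G.fst e, G.snd e} := by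
      ext v
      simp only [Set.mem_ofPred_eq, Set.mem_insert_iff, Set.mem_singleton_iff]
      constructor
      · rintro ⟨e', he', hb'⟩
        have : e' = e := hu e' ⟨by
          rcases he' with ⟨h1, h2⟩ | ⟨h1, h2⟩
          · simp [h1, h2]
          · simp [h1, h2, hf v], hb'⟩
        subst this
        rcases he'.inc with h | h
        · exact Or.inl h.symm
        · exact Or.inr h.symm
      · rintro (rfl | rfl)
        · exact ⟨e, Or.inl ⟨rfl, Eq.symm he⟩, heb⟩
        · exact ⟨e, Or.inr ⟨by rw [← show f (G.fst e) = G.snd e from he, hf], rfl⟩, heb⟩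
    rw [hset, Set.ncard_pair (G.no_loop e)]
  · intro u
    obtain ⟨M, hM, hrM⟩ := hcov (r u)
    obtain ⟨f, m, hf, hm, hu⟩ := hM.exists_involutive
    refine ⟨f, hf, fun v => ?_, ?_⟩
    · by_cases hb : G.Bichromatic c (m v)
      · exact Or.inr ⟨m v, hm v, hb⟩
      · exact Or.inl ⟨m v, hm v, hb⟩
    · have h1 := hm u
      rw [← hu u (r u) hrM (hr u).inc] at h1
      exact h1.eq_right (hr u)

end Multigraph

/-- No W-state graph is simple: every W-state graph contains at
least one pair of parallel edges. -/
theorem stmt16 {V E : Type} [Fintype V] [Fintype E] (G : Multigraph V E)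
    (c : E → V → Bool) (h : G.IsWState c) :
    ∃ e f : E, e ≠ f ∧ G.Parallel e f := by
  by_contra! h'
  exact Multigraph.not_isWState_of_forall_parallel_eq
    (fun e f hp => by_contra fun hne => h' e f hne hp) h
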